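/- arXiv:2011.07843 — 5 statements merged into one kernel-verified Lean document; each statement's English description precedes it below -/
import Mathlib

section
/- Let n ≥ 1, m > 0, σ > 0, μ ∈ {−1,1} and γ ∈ ℝ. Let 𝒱 : ℝ × ℝⁿ → ℂⁿ be C² and let 𝕃 be the associated complex transport–diffusion operator. Let U : ℝⁿ \ {0} → ℝ be differentiable and positively homogeneous of degree γ (U(λx) = λ^γ U(x) for all λ > 0, x ≠ 0), and suppose that m·𝕃[𝒱](t,x) = −∇U(x) for all t ∈ ℝ and all x ≠ 0. Then for all t ∈ ℝ and x ≠ 0, 𝕃[𝕃[g]](t,x) = 4K(𝒱(t,x)) − 2γ·U(x) + 2iμmσ²·div_x 𝒱(t,x), where g(t,x) = m‖x‖², K(z) = (m/2)·(z·z) with z·z = Σ_j z_j² the bilinear extension of the dot product to ℂⁿ, and div_x 𝒱 = Σ_j ∂_{x_j} 𝒱_j. (Strong stochastic virial theorem, analytic form.) -/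
open Complex

noncomputable section

/-- Time partial derivative of a complex-valued function of `(t, x)`. -/
def ptC {n : ℕ} (g : ℝ → (Fin n → ℝ) → ℂ) (t : ℝ) (x : Fin n → ℝ) : ℂ :=
  deriv (fun s => g s x) t

/-- Spatial partial derivative `∂_{x_j}` of a complex-valued function of `(t, x)`. -/
def pxC {n : ℕ} (g : ℝ → (Fin n → ℝ) → ℂ) (j : Fin n) (t : ℝ) (x : Fin n → ℝ) : ℂ :=
  fderiv ℝ (fun y => g t y) x (Pi.single j 1)

/-- Spatial Laplacian of a complex-valued function of `(t, x)`. -/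
def lapC {n : ℕ} (g : ℝ → (Fin n → ℝ) → ℂ) (t : ℝ) (x : Fin n → ℝ) : ℂ :=
  ∑ j, pxC (pxC g j) j t x

/-- The complex transport–diffusion operator
`𝕃[g] = ∂_t g + (𝒱·∇_x) g + iμ(σ²/2) Δ_x g` associated to the complex
velocity field `V`, the diffusion coefficient `σ` and `μ = ±1`. -/
def Lop {n : ℕ} (μ σ : ℝ) (V : ℝ → (Fin n → ℝ) → Fin n → ℂ)
    (g : ℝ → (Fin n → ℝ) → ℂ) (t : ℝ) (x : Fin n → ℝ) : ℂ :=
  ptC g t x + ∑ j, V t x j * pxC g j t x + I * μ * (σ ^ 2 / 2) * lapC g t x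

section TransportDiffusion

variable {n : ℕ} {f g : ℝ → (Fin n → ℝ) → ℂ}

lemma contDiff_spatial_slice {k : WithTop ℕ∞} (hf : ContDiff ℝ k (Function.uncurry f)) (t : ℝ) :
    ContDiff ℝ k (fun y => f t y) :=
  hf.comp (contDiff_prodMk_right t)

lemma contDiff_time_slice {k : WithTop ℕ∞} (hf : ContDiff ℝ k (Function.uncurry f))
    (x : Fin n → ℝ) : ContDiff ℝ k (fun s => f s x) :=
  hf.comp (contDiff_prodMk_left x)

lemma differentiableAt_pxC (hf : ContDiff ℝ 2 (Function.uncurry f)) (j : Fin n) (t : ℝ)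
    (x : Fin n → ℝ) : DifferentiableAt ℝ (fun y => pxC f j t y) x := by
  have h : ContDiff ℝ 1 (fderiv ℝ (fun y => f t y)) :=
    (contDiff_spatial_slice hf t).fderiv_right (by norm_num)
  exact ((h.differentiable one_ne_zero) x).clm_apply (differentiableAt_const _)

lemma pxC_add {t : ℝ} {x : Fin n → ℝ} (hf : DifferentiableAt ℝ (fun y => f t y) x)
    (hg : DifferentiableAt ℝ (fun y => g t y) x) (j : Fin n) :
    pxC (fun s y => f s y + g s y) j t x = pxC f j t x + pxC g j t x := by
  simp only [pxC]
  rw [fderiv_fun_add hf hg]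
  rfl

lemma pxC_mul {t : ℝ} {x : Fin n → ℝ} (hf : DifferentiableAt ℝ (fun y => f t y) x)
    (hg : DifferentiableAt ℝ (fun y => g t y) x) (j : Fin n) :
    pxC (fun s y => f s y * g s y) j t x = f t x * pxC g j t x + g t x * pxC f j t x := by
  simp only [pxC]
  rw [fderiv_fun_mul hf hg]
  rfl

lemma pxC_const (c : ℂ) (j : Fin n) : pxC (fun _ _ => c) j = fun _ _ => 0 := by
  funext t x
  simp [pxC]

lemma pxC_coord (i j : Fin n) :
    pxC (fun _ y => (y i : ℂ)) j = fun _ _ => if i = j then 1 else 0 := by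
  funext t x
  have h : HasFDerivAt (fun y : Fin n → ℝ => (y i : ℂ))
      (ofRealCLM.comp (ContinuousLinearMap.proj (R := ℝ) (φ := fun _ : Fin n => ℝ) i)) x :=
    (ofRealCLM.comp (ContinuousLinearMap.proj (R := ℝ) (φ := fun _ : Fin n => ℝ) i)).hasFDerivAt
  simp only [pxC]
  rw [h.fderiv]
  simp [Pi.single_apply, apply_ite ofReal]

lemma contDiff_coord {k : WithTop ℕ∞} (i : Fin n) :
    ContDiff ℝ k (Function.uncurry fun (_ : ℝ) (y : Fin n → ℝ) => (y i : ℂ)) :=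
  ofRealCLM.contDiff.comp ((contDiff_apply ℝ ℝ i).comp contDiff_snd)

variable (μ σ : ℝ) (V : ℝ → (Fin n → ℝ) → Fin n → ℂ)

lemma Lop_const (c : ℂ) (t : ℝ) (x : Fin n → ℝ) : Lop μ σ V (fun _ _ => c) t x = 0 := by
  simp [Lop, ptC, lapC, pxC_const]

lemma Lop_coord (i : Fin n) (t : ℝ) (x : Fin n → ℝ) :
    Lop μ σ V (fun _ y => (y i : ℂ)) t x = V t x i := by
  simp [Lop, ptC, lapC, pxC_coord, pxC_const]

lemma Lop_add (hf : ContDiff ℝ 2 (Function.uncurry f)) (hg : ContDiff ℝ 2 (Function.uncurry g))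
    (t : ℝ) (x : Fin n → ℝ) :
    Lop μ σ V (fun s y => f s y + g s y) t x = Lop μ σ V f t x + Lop μ σ V g t x := by
  have hfx := fun s => (contDiff_spatial_slice hf s).differentiable two_ne_zero
  have hgx := fun s => (contDiff_spatial_slice hg s).differentiable two_ne_zero
  have hpt : ptC (fun s y => f s y + g s y) t x = ptC f t x + ptC g t x :=
    deriv_fun_add ((contDiff_time_slice hf x).differentiable two_ne_zero t)
      ((contDiff_time_slice hg x).differentiable two_ne_zero t)
  have hpx (j : Fin n) : pxC (fun s y => f s y + g s y) j =
      fun s y => pxC f j s y + pxC g j s y := by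
    funext s y
    exact pxC_add (hfx s y) (hgx s y) j
  have hlap : lapC (fun s y => f s y + g s y) t x = lapC f t x + lapC g t x := by
    simp only [lapC, hpx, ← Finset.sum_add_distrib]
    exact Finset.sum_congr rfl fun j _ =>
      pxC_add (differentiableAt_pxC hf j t x) (differentiableAt_pxC hg j t x) j
  simp only [Lop, hpt, hlap, hpx, mul_add, Finset.sum_add_distrib]
  ring

/-- Leibniz rule for the transport–diffusion operator, with its carré du champ term. -/
lemma Lop_mul (hf : ContDiff ℝ 2 (Function.uncurry f)) (hg : ContDiff ℝ 2 (Function.uncurry g))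
    (t : ℝ) (x : Fin n → ℝ) :
    Lop μ σ V (fun s y => f s y * g s y) t x =
      f t x * Lop μ σ V g t x + g t x * Lop μ σ V f t x
        + I * μ * σ ^ 2 * ∑ j, pxC f j t x * pxC g j t x := by
  have hfx := fun s => (contDiff_spatial_slice hf s).differentiable two_ne_zero
  have hgx := fun s => (contDiff_spatial_slice hg s).differentiable two_ne_zero
  have hpt : ptC (fun s y => f s y * g s y) t x = ptC f t x * g t x + f t x * ptC g t x :=
    deriv_fun_mul ((contDiff_time_slice hf x).differentiable two_ne_zero t)
      ((contDiff_time_slice hg x).differentiable two_ne_zero t)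
  have hpx (j : Fin n) : pxC (fun s y => f s y * g s y) j =
      fun s y => f s y * pxC g j s y + g s y * pxC f j s y := by
    funext s y
    exact pxC_mul (hfx s y) (hgx s y) j
  have hlap : lapC (fun s y => f s y * g s y) t x =
      f t x * lapC g t x + g t x * lapC f t x + 2 * ∑ j, pxC f j t x * pxC g j t x := by
    simp only [lapC, hpx, Finset.mul_sum, ← Finset.sum_add_distrib]
    refine Finset.sum_congr rfl fun j _ => ?_
    have hdf := differentiableAt_pxC hf j t x
    have hdg := differentiableAt_pxC hg j t x
    rw [pxC_add ((hfx t x).fun_mul hdg) ((hgx t x).fun_mul hdf), pxC_mul (hfx t x) hdg,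
      pxC_mul (hgx t x) hdf]
    ring
  have htr : ∑ j, V t x j * pxC (fun s y => f s y * g s y) j t x =
      f t x * ∑ j, V t x j * pxC g j t x + g t x * ∑ j, V t x j * pxC f j t x := by
    simp only [hpx, Finset.mul_sum, ← Finset.sum_add_distrib]
    exact Finset.sum_congr rfl fun j _ => by ring
  simp only [Lop]
  rw [hpt, hlap, htr]
  ring

lemma Lop_const_mul (hf : ContDiff ℝ 2 (Function.uncurry f)) (c : ℂ) (t : ℝ)
    (x : Fin n → ℝ) : Lop μ σ V (fun s y => c * f s y) t x = c * Lop μ σ V f t x := by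
  rw [Lop_mul (f := fun _ _ => c) μ σ V contDiff_const hf]
  simp [Lop_const, pxC_const]

lemma Lop_sum {ι : Type*} (S : Finset ι) {F : ι → ℝ → (Fin n → ℝ) → ℂ}
    (hF : ∀ i, ContDiff ℝ 2 (Function.uncurry (F i))) (t : ℝ) (x : Fin n → ℝ) :
    Lop μ σ V (fun s y => ∑ i ∈ S, F i s y) t x = ∑ i ∈ S, Lop μ σ V (F i) t x := by
  classical
  induction S using Finset.induction_on with
  | empty => simpa using Lop_const μ σ V 0 t x
  | insert a S ha ih =>
    simp only [Finset.sum_insert ha]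
    rw [Lop_add μ σ V (g := fun s y => ∑ i ∈ S, F i s y) (hF a)
      (ContDiff.sum fun i _ => hF i), ih]

lemma Lop_coord_mul (hf : ContDiff ℝ 2 (Function.uncurry f)) (i : Fin n) (t : ℝ)
    (x : Fin n → ℝ) :
    Lop μ σ V (fun s y => (y i : ℂ) * f s y) t x =
      x i * Lop μ σ V f t x + f t x * V t x i + I * μ * σ ^ 2 * pxC f i t x := by
  rw [Lop_mul (f := fun _ y => (y i : ℂ)) μ σ V (contDiff_coord i) hf]
  simp [Lop_coord, pxC_coord]

lemma Lop_const_mul_sum_sq (m : ℂ) :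
    Lop μ σ V (fun _ y => m * ∑ j, (y j : ℂ) ^ 2) =
      fun t x => m * ∑ j, (2 * ((x j : ℂ) * V t x j) + I * μ * σ ^ 2) := by
  funext t x
  have hsq (j : Fin n) :
      ContDiff ℝ 2 (Function.uncurry fun (_ : ℝ) (y : Fin n → ℝ) => (y j : ℂ) ^ 2) :=
    (contDiff_coord j).pow 2
  rw [Lop_const_mul (f := fun _ y => ∑ j, (y j : ℂ) ^ 2) μ σ V
    (ContDiff.sum fun j _ => hsq j), Lop_sum μ σ V _ hsq]
  congr 1
  refine Finset.sum_congr rfl fun j _ => ?_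
  simp only [pow_two (ofReal _)]
  rw [Lop_coord_mul μ σ V (contDiff_coord j), Lop_coord, pxC_coord, if_pos rfl]
  ring

end TransportDiffusion

/-- Euler's identity for positively homogeneous functions. -/
lemma fderiv_apply_self_of_homogeneous {E : Type*} [NormedAddCommGroup E] [NormedSpace ℝ E]
    {U : E → ℝ} {γ : ℝ} {x : E} (hU : DifferentiableAt ℝ U x)
    (hhom : ∀ l : ℝ, 0 < l → U (l • x) = l ^ γ * U x) : fderiv ℝ U x x = γ * U x := by
  have hray : HasDerivAt (fun l : ℝ => l • x) x 1 := by
    simpa using (hasDerivAt_id (1 : ℝ)).smul_const x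
  have hU' : HasFDerivAt U (fderiv ℝ U x) ((1 : ℝ) • x) := by
    simpa using hU.hasFDerivAt
  have hpow : HasDerivAt (fun l : ℝ => l ^ γ * U x) (γ * U x) 1 := by
    simpa using (Real.hasDerivAt_rpow_const (p := γ) (Or.inl one_ne_zero)).mul_const (U x)
  have heq : (fun l : ℝ => U (l • x)) =ᶠ[nhds 1] fun l => l ^ γ * U x := by
    filter_upwards [lt_mem_nhds one_pos] with l hl using hhom l hl
  exact (hU'.comp_hasDerivAt 1 hray).unique (hpow.congr_of_eventuallyEq heq)

lemma sum_mul_fderiv_single {ι : Type*} [Fintype ι] [DecidableEq ι] (L : (ι → ℝ) →L[ℝ] ℝ)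
    (x : ι → ℝ) : ∑ j, x j * L (Pi.single j 1) = L x := by
  conv_rhs => rw [pi_eq_sum_univ' x, map_sum]
  refine Finset.sum_congr rfl fun j _ => ?_
  rw [map_smul, smul_eq_mul]

/-- **Strong stochastic virial theorem (analytic form).**
If `m 𝕃[𝒱] = -∇U` off the origin, with `U` positively homogeneous of degree `γ`,
then `𝕃[𝕃[m‖x‖²]] = 4K(𝒱) - 2γU + 2iμmσ² div 𝒱`, where `K(z) = (m/2) z·z`. -/
theorem strong_stochastic_virial
    (n : ℕ) (hn : 1 ≤ n) (m σ μ γ : ℝ) (hm : 0 < m) (hσ : 0 < σ)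
    (hμ : μ = 1 ∨ μ = -1)
    (V : ℝ → (Fin n → ℝ) → Fin n → ℂ)
    (hV : ContDiff ℝ 2 (Function.uncurry V))
    (U : (Fin n → ℝ) → ℝ)
    (hU : ∀ x : Fin n → ℝ, x ≠ 0 → DifferentiableAt ℝ U x)
    (hhom : ∀ l : ℝ, 0 < l → ∀ x : Fin n → ℝ, x ≠ 0 → U (l • x) = l ^ γ * U x)
    (hNewton : ∀ (t : ℝ) (x : Fin n → ℝ), x ≠ 0 → ∀ j : Fin n,
      (m : ℂ) * Lop μ σ V (fun s y => V s y j) t x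
        = - (fderiv ℝ U x (Pi.single j 1) : ℂ)) :
    ∀ (t : ℝ) (x : Fin n → ℝ), x ≠ 0 →
      Lop μ σ V (Lop μ σ V (fun _ y => (m : ℂ) * ∑ j, (y j : ℂ) ^ 2)) t x
        = 4 * ((m : ℂ) / 2 * ∑ j, V t x j ^ 2) - 2 * (γ : ℂ) * (U x : ℂ)
          + 2 * I * (μ : ℂ) * (m : ℂ) * (σ : ℂ) ^ 2
              * ∑ j, pxC (fun s y => V s y j) j t x := by
  intro t x hx
  have hVj (j : Fin n) : ContDiff ℝ 2 (Function.uncurry fun s y => V s y j) :=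
    (contDiff_apply ℝ ℂ j).comp hV
  have hxV (j : Fin n) :
      ContDiff ℝ 2 (Function.uncurry fun (s : ℝ) (y : Fin n → ℝ) => (y j : ℂ) * V s y j) :=
    (contDiff_coord j).mul (hVj j)
  have hterm (j : Fin n) : ContDiff ℝ 2 (Function.uncurry fun (s : ℝ) (y : Fin n → ℝ) =>
      2 * ((y j : ℂ) * V s y j) + I * μ * σ ^ 2) :=
    (contDiff_const.mul (hxV j)).add contDiff_const
  have hLterm (j : Fin n) :
      Lop μ σ V (fun s y => 2 * ((y j : ℂ) * V s y j) + I * μ * σ ^ 2) t x =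
        2 * (x j * Lop μ σ V (fun s y => V s y j) t x + V t x j * V t x j
          + I * μ * σ ^ 2 * pxC (fun s y => V s y j) j t x) := by
    rw [Lop_add (f := fun s y => 2 * ((y j : ℂ) * V s y j))
        (g := fun _ _ => I * μ * σ ^ 2) μ σ V (contDiff_const.mul (hxV j)) contDiff_const,
      Lop_const, Lop_const_mul μ σ V (hxV j), Lop_coord_mul μ σ V (hVj j), add_zero]
  have hEuler : ∑ j, (x j : ℂ) * (fderiv ℝ U x (Pi.single j 1) : ℂ) = γ * U x := by
    exact_mod_cast (sum_mul_fderiv_single (fderiv ℝ U x) x).trans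
      (fderiv_apply_self_of_homogeneous (hU x hx) fun l hl => hhom l hl x hx)
  rw [Lop_const_mul_sum_sq, Lop_const_mul
      (f := fun s y => ∑ j, (2 * ((y j : ℂ) * V s y j) + I * μ * σ ^ 2)) μ σ V
      (ContDiff.sum fun j _ => hterm j),
    Lop_sum μ σ V _ hterm, mul_assoc 2 (γ : ℂ), ← hEuler]
  simp only [hLterm, Finset.mul_sum, ← Finset.sum_add_distrib, ← Finset.sum_sub_distrib]
  refine Finset.sum_congr rfl fun j _ => ?_
  linear_combination 2 * (x j : ℂ) * hNewton t x hx j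
end
end

section
/- Let n ≥ 1, m > 0, σ > 0, μ ∈ {−1,1}. Let 𝒜 : ℝ × ℝⁿ → ℂ be C³ and U : ℝⁿ → ℝ be C¹, and suppose that the gradient field ∇𝒜 satisfies, for all (t,x), ∂_t∇𝒜 + (1/m)(∇𝒜·∇)∇𝒜 + iμ(σ²/2)Δ(∇𝒜) = −∇U (the differential stochastic Newton equation written for the gradient velocity field 𝒱 = ∇𝒜/m). Then for all (t,x), ∇_x [ ∂_t𝒜 + (1/(2m)) ∇𝒜·∇𝒜 + iμ(σ²/2)Δ𝒜 + U ](t,x) = 0; i.e. the complex action 𝒜 satisfies the stochastic Hamilton–Jacobi equation ∂_t𝒜 + (1/(2m))∇𝒜·∇𝒜 + iμ(σ²/2)Δ𝒜 = −U up to a spatially constant function of t. Here ∇𝒜·∇𝒜 = Σ_j (∂_{x_j}𝒜)². -/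
open Complex

noncomputable section

section PartialDerivatives

variable {n : ℕ} {g : ℝ → (Fin n → ℝ) → ℂ}

theorem ptC_eq_fderiv (hg : Differentiable ℝ (Function.uncurry g)) (t : ℝ) (x : Fin n → ℝ) :
    ptC g t x = fderiv ℝ (Function.uncurry g) (t, x) (1, 0) :=
  ((hg (t, x)).hasFDerivAt.comp_hasDerivAt (f := fun s : ℝ => (s, x)) t
    ((hasDerivAt_id t).prodMk (hasDerivAt_const t x))).deriv

theorem pxC_eq_fderiv (hg : Differentiable ℝ (Function.uncurry g)) (j : Fin n) (t : ℝ)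
    (x : Fin n → ℝ) :
    pxC g j t x = fderiv ℝ (Function.uncurry g) (t, x) (0, Pi.single j 1) := by
  have h : HasFDerivAt (fun y => g t y) _ x :=
    (hg (t, x)).hasFDerivAt.comp (f := fun y : Fin n → ℝ => (t, y)) x
      ((hasFDerivAt_const t x).prodMk (hasFDerivAt_id x))
  rw [pxC, h.fderiv]
  rfl

theorem uncurry_ptC (hg : Differentiable ℝ (Function.uncurry g)) :
    Function.uncurry (ptC g) = fun p => fderiv ℝ (Function.uncurry g) p (1, 0) :=
  funext fun p => ptC_eq_fderiv hg p.1 p.2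

theorem uncurry_pxC (hg : Differentiable ℝ (Function.uncurry g)) (j : Fin n) :
    Function.uncurry (pxC g j) =
      fun p => fderiv ℝ (Function.uncurry g) p (0, Pi.single j 1) :=
  funext fun p => pxC_eq_fderiv hg j p.1 p.2

theorem contDiff_ptC {k : WithTop ℕ∞} (hg : ContDiff ℝ (k + 1) (Function.uncurry g)) :
    ContDiff ℝ k (Function.uncurry (ptC g)) := by
  rw [uncurry_ptC (hg.differentiable (by simp))]
  exact (hg.fderiv_right le_rfl).clm_apply contDiff_const

theorem contDiff_pxC {k : WithTop ℕ∞} (hg : ContDiff ℝ (k + 1) (Function.uncurry g))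
    (j : Fin n) : ContDiff ℝ k (Function.uncurry (pxC g j)) := by
  rw [uncurry_pxC (hg.differentiable (by simp))]
  exact (hg.fderiv_right le_rfl).clm_apply contDiff_const

theorem fderiv_fderiv_apply_comm {E F : Type*} [NormedAddCommGroup E] [NormedSpace ℝ E]
    [NormedAddCommGroup F] [NormedSpace ℝ F] {f : E → F} (hf : ContDiff ℝ 2 f) (p v w : E) :
    fderiv ℝ (fun q => fderiv ℝ f q v) p w = fderiv ℝ (fun q => fderiv ℝ f q w) p v := by
  have hd : DifferentiableAt ℝ (fderiv ℝ f) p :=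
    (hf.fderiv_right (m := 1) (by norm_num)).differentiable one_ne_zero p
  rw [fderiv_clm_apply hd (differentiableAt_const v),
    fderiv_clm_apply hd (differentiableAt_const w)]
  simpa using (hf.contDiffAt.isSymmSndFDerivAt (by simp)).eq w v

theorem pxC_ptC (hg : ContDiff ℝ 2 (Function.uncurry g)) (j : Fin n) :
    pxC (ptC g) j = ptC (pxC g j) := by
  have hd := hg.differentiable two_ne_zero
  have hg' : ContDiff ℝ (1 + 1) (Function.uncurry g) := by simpa [one_add_one_eq_two] using hg
  ext t x
  rw [pxC_eq_fderiv ((contDiff_ptC hg').differentiable one_ne_zero),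
    ptC_eq_fderiv ((contDiff_pxC hg' j).differentiable one_ne_zero),
    uncurry_ptC hd, uncurry_pxC hd, fderiv_fderiv_apply_comm hg]

theorem pxC_comm (hg : ContDiff ℝ 2 (Function.uncurry g)) (j k : Fin n) :
    pxC (pxC g k) j = pxC (pxC g j) k := by
  have hd := hg.differentiable two_ne_zero
  have hg' : ContDiff ℝ (1 + 1) (Function.uncurry g) := by simpa [one_add_one_eq_two] using hg
  ext t x
  rw [pxC_eq_fderiv ((contDiff_pxC hg' k).differentiable one_ne_zero),
    pxC_eq_fderiv ((contDiff_pxC hg' j).differentiable one_ne_zero),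
    uncurry_pxC hd, uncurry_pxC hd, fderiv_fderiv_apply_comm hg]

theorem hasFDerivAt_slice (hg : ContDiff ℝ 1 (Function.uncurry g)) (t : ℝ) (x : Fin n → ℝ) :
    HasFDerivAt (fun y => g t y) (fderiv ℝ (fun y => g t y) x) x :=
  ((hg.comp (contDiff_const.prodMk contDiff_id)).differentiable one_ne_zero x).hasFDerivAt

end PartialDerivatives

/-- **Stochastic Hamilton–Jacobi equation from the gradient stochastic Newton equation.**
If the gradient field `∇𝒜` satisfies
`∂_t ∇𝒜 + (1/m)(∇𝒜·∇)∇𝒜 + iμ(σ²/2)Δ(∇𝒜) = -∇U`, then the complex action `𝒜`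
satisfies `∇[∂_t 𝒜 + (1/(2m)) ∇𝒜·∇𝒜 + iμ(σ²/2) Δ𝒜 + U] = 0`. -/
theorem stochastic_hamilton_jacobi
    (n : ℕ) (hn : 1 ≤ n) (m σ μ : ℝ) (hm : 0 < m) (hσ : 0 < σ)
    (hμ : μ = 1 ∨ μ = -1)
    (A : ℝ → (Fin n → ℝ) → ℂ)
    (hA : ContDiff ℝ 3 (Function.uncurry A))
    (U : (Fin n → ℝ) → ℝ) (hU : ContDiff ℝ 1 U)
    (hNewton : ∀ (t : ℝ) (x : Fin n → ℝ) (j : Fin n),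
      ptC (fun s y => pxC A j s y) t x
        + (1 / (m : ℂ)) * ∑ k, pxC A k t x * pxC (fun s y => pxC A j s y) k t x
        + I * (μ : ℂ) * ((σ : ℂ) ^ 2 / 2) * lapC (fun s y => pxC A j s y) t x
        = - (fderiv ℝ U x (Pi.single j 1) : ℂ)) :
    ∀ (t : ℝ) (x : Fin n → ℝ) (j : Fin n),
      pxC (fun s y =>
          ptC A s y + (1 / (2 * (m : ℂ))) * ∑ k, pxC A k s y ^ 2
            + I * (μ : ℂ) * ((σ : ℂ) ^ 2 / 2) * lapC A s y + (U y : ℂ)) j t x = 0 := by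
  intro t x j
  have hA2 : ContDiff ℝ 2 (Function.uncurry A) := hA.of_le (by norm_num)
  have hA21 : ContDiff ℝ (2 + 1) (Function.uncurry A) := by
    simpa [two_add_one_eq_three] using hA
  have hAx (k : Fin n) : ContDiff ℝ (1 + 1) (Function.uncurry (pxC A k)) := by
    simpa [one_add_one_eq_two] using contDiff_pxC hA21 k
  have hAx1 (k : Fin n) : ContDiff ℝ 1 (Function.uncurry (pxC A k)) := (hAx k).of_le (by simp)
  have hAt : ContDiff ℝ 1 (Function.uncurry (ptC A)) :=
    (contDiff_ptC hA21).of_le one_le_two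
  have hUd : HasFDerivAt (fun y => (U y : ℂ)) (ofRealCLM.comp (fderiv ℝ U x)) x :=
    ofRealCLM.hasFDerivAt.comp x (hU.differentiable one_ne_zero x).hasFDerivAt
  have hsq := HasFDerivAt.fun_sum (u := Finset.univ) fun (k : Fin n) _ =>
    (hasFDerivAt_slice (hAx1 k) t x).pow 2
  have hlap : HasFDerivAt (fun y => lapC A t y) _ x :=
    HasFDerivAt.fun_sum (u := Finset.univ) fun (k : Fin n) _ =>
      hasFDerivAt_slice (contDiff_pxC (hAx k) k) t x
  have hmain := (((hasFDerivAt_slice hAt t x).add (hsq.const_mul (1 / (2 * (m : ℂ))))).add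
    (hlap.const_mul (I * (μ : ℂ) * ((σ : ℂ) ^ 2 / 2)))).add hUd
  have hderiv := congrArg (fun L => L (Pi.single j 1)) hmain.fderiv
  refine hderiv.trans ?_
  have hN := hNewton t x j
  have ht : ptC (pxC A j) t x = fderiv ℝ (fun y => ptC A t y) x (Pi.single j 1) := by
    rw [← pxC_ptC hA2]; rfl
  have hx (k : Fin n) :
      pxC (pxC A j) k t x = fderiv ℝ (fun y => pxC A k t y) x (Pi.single j 1) := by
    rw [pxC_comm hA2]; rfl
  have hl : lapC (pxC A j) t x =
      ∑ k, fderiv ℝ (fun y => pxC (pxC A k) k t y) x (Pi.single j 1) := by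
    refine Finset.sum_congr rfl fun k _ => ?_
    rw [pxC_comm hA2 k j, pxC_comm ((hAx k).of_le (by norm_num)) k j]; rfl
  simp only [ht, hx, hl] at hN
  have hsum : (1 / (2 * (m : ℂ))) * ∑ k, 2 * pxC A k t x *
        fderiv ℝ (fun y => pxC A k t y) x (Pi.single j 1) =
      (1 / (m : ℂ)) * ∑ k, pxC A k t x *
        fderiv ℝ (fun y => pxC A k t y) x (Pi.single j 1) := by
    simp only [Finset.mul_sum]
    exact Finset.sum_congr rfl fun k _ => by field_simp
  simp only [add_apply, smul_apply, sum_apply, ContinuousLinearMap.comp_apply,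
    ofRealCLM_apply, smul_eq_mul, nsmul_eq_mul, Nat.cast_ofNat, Nat.add_one_sub_one, pow_one]
  rw [hsum, hN, neg_add_cancel]
end
end

section
/- Let n ≥ 1, m > 0, σ > 0. Let p : ℝ × ℝⁿ → ℝ be C² in the space variable with p(t,x) > 0 everywhere, and set R = (mσ²/2)·ln p. Then for all (t,x): −(1/(2m))‖∇R(t,x)‖² − (σ²/2)ΔR(t,x) = −m(σ⁴/2)·Δ(√p)(t,x)/√p(t,x), where ∇ and Δ are taken in the space variable. Consequently, for any C¹ function S : ℝ × ℝⁿ → ℝ and any U : ℝⁿ → ℝ, the equation ∂_tS + (1/(2m))‖∇S‖² − (1/(2m))‖∇R‖² − (σ²/2)ΔR + U = 0 is equivalent to the modified Hamilton–Jacobi equation ∂_tS + (1/(2m))‖∇S‖² − m(σ⁴/2)·Δ(√p)/√p + U = 0. -/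
noncomputable section

/-- Time partial derivative of a real-valued function of `(t, x)`. -/
def ptR {n : ℕ} (g : ℝ → (Fin n → ℝ) → ℝ) (t : ℝ) (x : Fin n → ℝ) : ℝ :=
  deriv (fun s => g s x) t

/-- Spatial partial derivative `∂_{x_j}` of a real-valued function of `(t, x)`. -/
def pxR {n : ℕ} (g : ℝ → (Fin n → ℝ) → ℝ) (j : Fin n) (t : ℝ) (x : Fin n → ℝ) : ℝ :=
  fderiv ℝ (fun y => g t y) x (Pi.single j 1)

/-- Spatial Laplacian of a real-valued function of `(t, x)`. -/
def lapR {n : ℕ} (g : ℝ → (Fin n → ℝ) → ℝ) (t : ℝ) (x : Fin n → ℝ) : ℝ :=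
  ∑ j, pxR (pxR g j) j t x

/-- First-order chain rule for the spatial partial derivatives of `φ ∘ p`. -/
theorem pxR_comp {n : ℕ} {p : ℝ → (Fin n → ℝ) → ℝ} {φ φ' : ℝ → ℝ} {t : ℝ}
    (hp : Differentiable ℝ (p t)) (hφ : ∀ x, HasDerivAt φ (φ' (p t x)) (p t x))
    (j : Fin n) (x : Fin n → ℝ) :
    pxR (fun s y => φ (p s y)) j t x = φ' (p t x) * pxR p j t x := by
  have h := ((hφ x).comp_hasFDerivAt x (hp x).hasFDerivAt).fderiv
  change fderiv ℝ (φ ∘ p t) x (Pi.single j 1) = _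
  rw [h]
  rfl

/-- Second-order chain rule for the spatial partial derivatives of `φ ∘ p`. -/
theorem pxR_pxR_comp {n : ℕ} {p : ℝ → (Fin n → ℝ) → ℝ} {φ φ' φ'' : ℝ → ℝ} {t : ℝ}
    (hp : ContDiff ℝ 2 (p t)) (hφ : ∀ x, HasDerivAt φ (φ' (p t x)) (p t x))
    (hφ' : ∀ x, HasDerivAt φ' (φ'' (p t x)) (p t x)) (j : Fin n) (x : Fin n → ℝ) :
    pxR (pxR (fun s y => φ (p s y)) j) j t x
      = φ'' (p t x) * pxR p j t x ^ 2 + φ' (p t x) * pxR (pxR p j) j t x := by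
  have hd : Differentiable ℝ (p t) := hp.differentiable (by norm_num)
  have hpx : Differentiable ℝ (pxR p j t) :=
    ((hp.fderiv_right (m := 1) (by norm_num)).clm_apply contDiff_const).differentiable
      (by norm_num)
  have hfun : pxR (fun s y => φ (p s y)) j t = fun y => φ' (p t y) * pxR p j t y :=
    funext (pxR_comp hd hφ j)
  have h1 : HasFDerivAt (fun y => φ' (p t y)) (φ'' (p t x) • fderiv ℝ (p t) x) x :=
    (hφ' x).comp_hasFDerivAt x (hd x).hasFDerivAt
  have h2 := (h1.mul (hpx x).hasFDerivAt).fderiv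
  change fderiv ℝ (pxR (fun s y => φ (p s y)) j t) x (Pi.single j 1) = _
  rw [hfun]
  change fderiv ℝ ((fun y => φ' (p t y)) * pxR p j t) x (Pi.single j 1) = _
  rw [h2]
  change φ' (p t x) * pxR (pxR p j) j t x
    + pxR p j t x * (φ'' (p t x) * pxR p j t x) = _
  ring

/-- The derivative of `u ↦ 1 / (2 √u)` at a positive point. -/
theorem hasDerivAt_one_div_two_mul_sqrt {u : ℝ} (hu : 0 < u) :
    HasDerivAt (fun v => 1 / (2 * √v)) (-(1 / (4 * u * √u))) u := by
  have hs : √u ≠ 0 := (Real.sqrt_pos.2 hu).ne'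
  have h := ((Real.hasDerivAt_sqrt hu.ne').const_mul 2).inv (by positivity)
  simp only [one_div]
  refine h.congr_deriv ?_
  have hq : √u ^ 2 = u := Real.sq_sqrt hu.le
  rw [mul_pow, hq]
  field_simp
  norm_num

/-- **Identification of the induced stochastic (Bohm) potential.**
With `R = (mσ²/2) ln p` for a positive density `p`, one has
`-(1/(2m))‖∇R‖² - (σ²/2)ΔR = -m(σ⁴/2) Δ(√p)/√p`, and consequently the real part of
the stochastic Hamilton–Jacobi equation is equivalent to the modified
Hamilton–Jacobi equation with potential `U + U_{σ,induced}`. -/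
theorem induced_potential_and_modified_HJ
    (n : ℕ) (hn : 1 ≤ n) (m σ : ℝ) (hm : 0 < m) (hσ : 0 < σ)
    (p : ℝ → (Fin n → ℝ) → ℝ)
    (hp : ∀ (t : ℝ) (x : Fin n → ℝ), 0 < p t x)
    (hpC2 : ∀ t : ℝ, ContDiff ℝ 2 (fun x => p t x))
    (R : ℝ → (Fin n → ℝ) → ℝ)
    (hR : ∀ (t : ℝ) (x : Fin n → ℝ), R t x = m * σ ^ 2 / 2 * Real.log (p t x)) :
    (∀ (t : ℝ) (x : Fin n → ℝ),
        -(1 / (2 * m)) * ∑ j, pxR R j t x ^ 2 - σ ^ 2 / 2 * lapR R t x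
          = -(m * (σ ^ 4 / 2))
              * lapR (fun s y => Real.sqrt (p s y)) t x / Real.sqrt (p t x))
      ∧ ∀ (S : ℝ → (Fin n → ℝ) → ℝ), ContDiff ℝ 1 (Function.uncurry S) →
          ∀ (U : (Fin n → ℝ) → ℝ) (t : ℝ) (x : Fin n → ℝ),
            (ptR S t x + 1 / (2 * m) * ∑ j, pxR S j t x ^ 2
                - 1 / (2 * m) * ∑ j, pxR R j t x ^ 2
                - σ ^ 2 / 2 * lapR R t x + U x = 0
              ↔ ptR S t x + 1 / (2 * m) * ∑ j, pxR S j t x ^ 2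
                - m * (σ ^ 4 / 2)
                    * lapR (fun s y => Real.sqrt (p s y)) t x / Real.sqrt (p t x)
                + U x = 0) := by
  have key : ∀ (t : ℝ) (x : Fin n → ℝ),
      -(1 / (2 * m)) * ∑ j, pxR R j t x ^ 2 - σ ^ 2 / 2 * lapR R t x
        = -(m * (σ ^ 4 / 2))
            * lapR (fun s y => Real.sqrt (p s y)) t x / Real.sqrt (p t x) := by
    intro t x
    obtain rfl : R = fun t x => m * σ ^ 2 / 2 * Real.log (p t x) :=
      funext fun t => funext (hR t)
    have hlog : ∀ y, HasDerivAt (fun u => m * σ ^ 2 / 2 * Real.log u)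
        (m * σ ^ 2 / 2 * (p t y)⁻¹) (p t y) := fun y =>
      (Real.hasDerivAt_log (hp t y).ne').const_mul _
    have hinv : ∀ y, HasDerivAt (fun u => m * σ ^ 2 / 2 * u⁻¹)
        (m * σ ^ 2 / 2 * -(p t y ^ 2)⁻¹) (p t y) := fun y =>
      (hasDerivAt_inv (hp t y).ne').const_mul _
    have hR1 := pxR_comp (φ := fun u => m * σ ^ 2 / 2 * Real.log u)
      (φ' := fun u => m * σ ^ 2 / 2 * u⁻¹) ((hpC2 t).differentiable (by norm_num)) hlog
    have hR2 := pxR_pxR_comp (φ := fun u => m * σ ^ 2 / 2 * Real.log u)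
      (φ' := fun u => m * σ ^ 2 / 2 * u⁻¹)
      (φ'' := fun u => m * σ ^ 2 / 2 * -(u ^ 2)⁻¹) (hpC2 t) hlog hinv
    have hS2 := pxR_pxR_comp (φ := Real.sqrt) (φ' := fun u => 1 / (2 * √u))
      (φ'' := fun u => -(1 / (4 * u * √u))) (hpC2 t)
      (fun y => Real.hasDerivAt_sqrt (hp t y).ne')
      (fun y => hasDerivAt_one_div_two_mul_sqrt (hp t y))
    simp only [lapR, hR1, hR2, hS2, Finset.mul_sum, Finset.sum_div,
      ← Finset.sum_sub_distrib]
    refine Finset.sum_congr rfl fun j _ => ?_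
    have hu := hp t x
    have hs : 0 < √(p t x) := Real.sqrt_pos.2 hu
    have hq : √(p t x) ^ 2 = p t x := Real.sq_sqrt hu.le
    generalize √(p t x) = r at hs hq ⊢
    rw [← hq]
    field_simp
    ring
  refine ⟨key, fun S _ U t x => ?_⟩
  have h := key t x
  rw [neg_mul, neg_mul, neg_div] at h
  constructor <;> intro h' <;> linarith
end
end

section
/- Let n ≥ 1, m > 0, σ > 0, μ ∈ {−1,1}, and let C be a nonzero real constant. Let 𝒜 : ℝ × ℝⁿ → ℂ be C² and U : ℝⁿ → ℝ, and suppose 𝒜 satisfies the stochastic Hamilton–Jacobi equation ∂_t𝒜 + (1/(2m))∇𝒜·∇𝒜 + iμ(σ²/2)Δ𝒜 = −U, where ∇𝒜·∇𝒜 = Σ_j (∂_{x_j}𝒜)². Define the wave function ψ : ℝ × ℝⁿ → ℂ by ψ = exp(i𝒜/C) (so ψ never vanishes). Then ψ satisfies the nonlinear partial differential equation iC·∂_tψ − μ(σ²C/2)·Δψ + (C(μmσ² + C)/(2m))·(∇ψ·∇ψ)/ψ = ψ·U, where ∇ψ·∇ψ = Σ_j (∂_{x_j}ψ)². -/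
open Complex

noncomputable section

/-- Chain rule for the spatial partial derivative of `exp (I * A / c)`. -/
theorem pxC_exp {n : ℕ} {A : ℝ → (Fin n → ℝ) → ℂ} {t : ℝ} {x : Fin n → ℝ} (c : ℂ) (j : Fin n)
    (hA : DifferentiableAt ℝ (A t) x) :
    pxC (fun s y => Complex.exp (I * A s y / c)) j t x
      = I / c * pxC A j t x * Complex.exp (I * A t x / c) := by
  have h : HasFDerivAt (fun y => Complex.exp (I * A t y / c)) _ x :=
    ((hA.hasFDerivAt.const_mul I).mul_const c⁻¹).cexp
  unfold pxC
  rw [h.fderiv]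
  simp only [smul_apply, smul_eq_mul]
  ring_nf

/-- The second spatial partial derivative of `exp (I * A / c)`. -/
theorem pxC_pxC_exp {n : ℕ} {A : ℝ → (Fin n → ℝ) → ℂ} {t : ℝ} (x : Fin n → ℝ) (c : ℂ) (j : Fin n)
    (hA : ContDiff ℝ 2 (A t)) :
    pxC (pxC (fun s y => Complex.exp (I * A s y / c)) j) j t x
      = (I / c * pxC (pxC A j) j t x + (I / c * pxC A j t x) ^ 2)
        * Complex.exp (I * A t x / c) := by
  have hd : Differentiable ℝ (A t) := hA.differentiable (by norm_num)
  have hp : DifferentiableAt ℝ (pxC A j t) x :=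
    (((hA.fderiv_right (m := 1) (by norm_num)).differentiable (by norm_num)) x).clm_apply
      (differentiableAt_const _)
  have he : HasFDerivAt (fun y => Complex.exp (I * A t y / c)) _ x :=
    (((hd x).hasFDerivAt.const_mul I).mul_const c⁻¹).cexp
  have h := (hp.hasFDerivAt.const_mul (I / c)).mul he
  have hfun : (fun y => pxC (fun s y => Complex.exp (I * A s y / c)) j t y)
      = fun y => I / c * pxC A j t y * Complex.exp (I * A t y / c) :=
    funext fun y => pxC_exp c j (hd y)
  rw [pxC, hfun]
  refine (congrArg (fun L => L (Pi.single j 1)) h.fderiv).trans ?_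
  simp only [add_apply, smul_apply, smul_eq_mul]
  change _ * (_ * (_ * (I * pxC A j t x))) + _ * (_ * pxC (pxC A j) j t x) = _
  ring_nf

/-- Chain rule for the time derivative of `exp (I * A / c)`. -/
theorem ptC_exp {n : ℕ} {A : ℝ → (Fin n → ℝ) → ℂ} {t : ℝ} {x : Fin n → ℝ} (c : ℂ)
    (hA : DifferentiableAt ℝ (fun s => A s x) t) :
    ptC (fun s y => Complex.exp (I * A s y / c)) t x
      = I / c * ptC A t x * Complex.exp (I * A t x / c) := by
  have h : HasDerivAt (fun s => Complex.exp (I * A s x / c)) _ t :=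
    ((hA.hasDerivAt.const_mul I).div_const c).cexp
  unfold ptC
  rw [h.deriv]
  ring

/-- **Nonlinear Schrödinger equation for the wave function.**
If the complex action `𝒜` satisfies the stochastic Hamilton–Jacobi equation, then
`ψ = exp(i𝒜/C)` satisfies
`iC ∂_tψ - μ(σ²C/2)Δψ + (C(μmσ²+C)/(2m)) (∇ψ·∇ψ)/ψ = ψU`. -/
theorem nonlinear_schrodinger
    (n : ℕ) (hn : 1 ≤ n) (m σ μ C : ℝ) (hm : 0 < m) (hσ : 0 < σ)
    (hμ : μ = 1 ∨ μ = -1) (hC : C ≠ 0)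
    (A : ℝ → (Fin n → ℝ) → ℂ) (hA : ContDiff ℝ 2 (Function.uncurry A))
    (U : (Fin n → ℝ) → ℝ)
    (hHJ : ∀ (t : ℝ) (x : Fin n → ℝ),
      ptC A t x + (1 / (2 * (m : ℂ))) * ∑ j, pxC A j t x ^ 2
        + I * (μ : ℂ) * ((σ : ℂ) ^ 2 / 2) * lapC A t x = - (U x : ℂ)) :
    ∀ (t : ℝ) (x : Fin n → ℝ),
      I * (C : ℂ) * ptC (fun s y => Complex.exp (I * A s y / (C : ℂ))) t x
        - (μ : ℂ) * ((σ : ℂ) ^ 2 * (C : ℂ) / 2)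
            * lapC (fun s y => Complex.exp (I * A s y / (C : ℂ))) t x
        + (C : ℂ) * ((μ : ℂ) * (m : ℂ) * (σ : ℂ) ^ 2 + (C : ℂ)) / (2 * (m : ℂ))
            * (∑ j, pxC (fun s y => Complex.exp (I * A s y / (C : ℂ))) j t x ^ 2)
            / Complex.exp (I * A t x / (C : ℂ))
        = Complex.exp (I * A t x / (C : ℂ)) * (U x : ℂ) := by
  intro t x
  have hAx : ContDiff ℝ 2 (A t) := hA.comp (contDiff_prodMk_right t)
  have hAt : ContDiff ℝ 2 (fun s => A s x) := hA.comp (contDiff_prodMk_left x)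
  have hm' : (m : ℂ) ≠ 0 := mod_cast hm.ne'
  have hC' : (C : ℂ) ≠ 0 := mod_cast hC
  have hE : Complex.exp (I * A t x / (C : ℂ)) ≠ 0 := Complex.exp_ne_zero _
  have hlap : lapC (fun s y => Complex.exp (I * A s y / (C : ℂ))) t x
      = (I / C * lapC A t x + (I / C) ^ 2 * ∑ j, pxC A j t x ^ 2)
        * Complex.exp (I * A t x / (C : ℂ)) := by
    simp only [lapC, pxC_pxC_exp x (C : ℂ) _ hAx, mul_pow, ← Finset.sum_mul,
      Finset.sum_add_distrib, Finset.mul_sum]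
  have hgrad : ∑ j, pxC (fun s y => Complex.exp (I * A s y / (C : ℂ))) j t x ^ 2
      = (I / C) ^ 2 * (∑ j, pxC A j t x ^ 2) * Complex.exp (I * A t x / (C : ℂ)) ^ 2 := by
    simp only [pxC_exp (C : ℂ) _ (hAx.differentiable (by norm_num) x), mul_pow,
      ← Finset.sum_mul, Finset.mul_sum]
  rw [hlap, hgrad, ptC_exp (C : ℂ) (hAt.differentiable (by norm_num) t),
    ← neg_neg ((U x : ℝ) : ℂ), ← hHJ t x]
  generalize Complex.exp (I * A t x / (C : ℂ)) = E at hE ⊢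
  field_simp
  ring_nf
  simp only [I_sq]
  ring
end
end

section
/- Let n ≥ 1, m > 0, σ > 0, μ ∈ {−1,1}. Let 𝒜 : ℝ × ℝⁿ → ℂ be C², U : ℝⁿ → ℝ, and suppose 𝒜 satisfies the stochastic Hamilton–Jacobi equation ∂_t𝒜 + (1/(2m))∇𝒜·∇𝒜 + iμ(σ²/2)Δ𝒜 = −U. Choose the normalization constant C = −μmσ² and set ψ = exp(i𝒜/C). Then the nonlinear term cancels and ψ satisfies the linear partial differential equation −iμmσ²·∂_tψ + m(σ⁴/2)·Δψ = ψ·U. In particular, for μ = −1, ψ satisfies the linear Schrödinger equation imσ²·∂_tψ + m(σ⁴/2)·Δψ = ψ·U. -/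
open Complex

noncomputable section

/-- Chain rule for the time derivative of `exp (c * g)`. -/
theorem ptC_exp_mul {n : ℕ} {g : ℝ → (Fin n → ℝ) → ℂ} (c : ℂ) {t : ℝ} {x : Fin n → ℝ}
    (hg : DifferentiableAt ℝ (fun s => g s x) t) :
    ptC (fun s y => exp (c * g s y)) t x = c * ptC g t x * exp (c * g t x) := by
  unfold ptC
  rw [((hg.hasDerivAt.const_mul c).cexp).deriv]
  ring

/-- Chain rule for the spatial partial derivatives of `exp (c * g)`. -/
theorem pxC_exp_mul {n : ℕ} {g : ℝ → (Fin n → ℝ) → ℂ} (c : ℂ) (j : Fin n) {t : ℝ}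
    {x : Fin n → ℝ} (hg : DifferentiableAt ℝ (g t) x) :
    pxC (fun s y => exp (c * g s y)) j t x = c * pxC g j t x * exp (c * g t x) := by
  unfold pxC
  rw [((hg.hasFDerivAt.const_mul c).cexp).fderiv]
  simp only [smul_apply, smul_eq_mul]
  ring

/-- The spatial partial derivatives of a spatially `C²` function are differentiable in space. -/
theorem differentiable_pxC {n : ℕ} {g : ℝ → (Fin n → ℝ) → ℂ} {t : ℝ}
    (hg : ContDiff ℝ 2 (g t)) (j : Fin n) : Differentiable ℝ (pxC g j t) :=
  ((hg.fderiv_right (m := 1) (by norm_num)).differentiable (by norm_num)).clm_apply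
    (differentiable_const _)

/-- The Laplacian of `exp (c * g)`. -/
theorem lapC_exp_mul {n : ℕ} {g : ℝ → (Fin n → ℝ) → ℂ} (c : ℂ) {t : ℝ}
    (hg : ContDiff ℝ 2 (g t)) (x : Fin n → ℝ) :
    lapC (fun s y => exp (c * g s y)) t x =
      (c * lapC g t x + c ^ 2 * ∑ j, pxC g j t x ^ 2) * exp (c * g t x) := by
  have hd : Differentiable ℝ (g t) := hg.differentiable (by norm_num)
  unfold lapC
  rw [Finset.mul_sum, Finset.mul_sum, ← Finset.sum_add_distrib, Finset.sum_mul]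
  refine Finset.sum_congr rfl fun j _ => ?_
  have hfun : (fun y => pxC (fun s y => exp (c * g s y)) j t y) =
      fun y => c * pxC g j t y * exp (c * g t y) := funext fun y => pxC_exp_mul c j (hd y)
  have hp : HasFDerivAt (fun y => c * pxC g j t y * exp (c * g t y)) _ x :=
    ((differentiable_pxC hg j x).hasFDerivAt.const_mul c).mul
      ((hd x).hasFDerivAt.const_mul c).cexp
  have h1 : pxC g j t x = fderiv ℝ (g t) x (Pi.single j 1) := rfl
  have h2 : pxC (pxC g j) j t x = fderiv ℝ (pxC g j t) x (Pi.single j 1) := rfl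
  rw [pxC, hfun, hp.fderiv, h2]
  simp only [add_apply, smul_apply, smul_eq_mul, ← h1]
  ring

/-- **Linear Schrödinger equation for the normalized wave function.**
If `𝒜` satisfies the stochastic Hamilton–Jacobi equation and `C = -μmσ²`, then
`ψ = exp(i𝒜/C)` satisfies the linear equation
`-iμmσ² ∂_tψ + m(σ⁴/2)Δψ = ψU`; in particular, for `μ = -1`,
`imσ² ∂_tψ + m(σ⁴/2)Δψ = ψU`. -/
theorem linear_schrodinger
    (n : ℕ) (hn : 1 ≤ n) (m σ μ : ℝ) (hm : 0 < m) (hσ : 0 < σ)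
    (hμ : μ = 1 ∨ μ = -1)
    (A : ℝ → (Fin n → ℝ) → ℂ) (hA : ContDiff ℝ 2 (Function.uncurry A))
    (U : (Fin n → ℝ) → ℝ)
    (hHJ : ∀ (t : ℝ) (x : Fin n → ℝ),
      ptC A t x + (1 / (2 * (m : ℂ))) * ∑ j, pxC A j t x ^ 2
        + I * (μ : ℂ) * ((σ : ℂ) ^ 2 / 2) * lapC A t x = - (U x : ℂ))
    (C : ℝ) (hC : C = -μ * m * σ ^ 2)
    (ψ : ℝ → (Fin n → ℝ) → ℂ)
    (hψ : ∀ (t : ℝ) (x : Fin n → ℝ), ψ t x = Complex.exp (I * A t x / (C : ℂ))) :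
    (∀ (t : ℝ) (x : Fin n → ℝ),
        -(I * (μ : ℂ) * (m : ℂ) * (σ : ℂ) ^ 2) * ptC ψ t x
          + (m : ℂ) * ((σ : ℂ) ^ 4 / 2) * lapC ψ t x = ψ t x * (U x : ℂ))
      ∧ (μ = -1 → ∀ (t : ℝ) (x : Fin n → ℝ),
          I * (m : ℂ) * (σ : ℂ) ^ 2 * ptC ψ t x
            + (m : ℂ) * ((σ : ℂ) ^ 4 / 2) * lapC ψ t x = ψ t x * (U x : ℂ)) := by
  have hC0 : (C : ℂ) ≠ 0 := by
    rw [hC]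
    rcases hμ with rfl | rfl <;> simp [hm.ne', hσ.ne']
  have hm0 : (m : ℂ) ≠ 0 := by exact_mod_cast hm.ne'
  have hCc : (C : ℂ) = -μ * m * σ ^ 2 := by rw [hC]; push_cast; ring
  have hC2 : (C : ℂ) ^ 2 = m ^ 2 * σ ^ 4 := by
    rw [hCc]
    rcases hμ with rfl | rfl <;> push_cast <;> ring
  have hψ' : ψ = fun t x => exp (I / C * A t x) := by
    funext t x
    rw [hψ, mul_div_right_comm]
  have main : ∀ (t : ℝ) (x : Fin n → ℝ),
      -(I * (μ : ℂ) * (m : ℂ) * (σ : ℂ) ^ 2) * ptC ψ t x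
        + (m : ℂ) * ((σ : ℂ) ^ 4 / 2) * lapC ψ t x = ψ t x * (U x : ℂ) := by
    intro t x
    have ht : DifferentiableAt ℝ (fun s => A s x) t :=
      (hA.comp (contDiff_id.prodMk contDiff_const)).differentiable (by norm_num) t
    have hx : ContDiff ℝ 2 (A t) := hA.comp (contDiff_const.prodMk contDiff_id)
    rw [hψ', ptC_exp_mul _ ht, lapC_exp_mul _ hx]
    have h1 : -(I * (μ : ℂ) * m * σ ^ 2) = I * C := by rw [hCc]; ring
    have h2 : (m : ℂ) * (σ ^ 4 / 2) = C ^ 2 / (2 * m) := by rw [hC2]; field_simp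
    have h3 : I * (μ : ℂ) * (σ ^ 2 / 2) = -(I * C) / (2 * m) := by rw [hCc]; field_simp
    have hU : (U x : ℂ) = -(ptC A t x + (1 / (2 * (m : ℂ))) * ∑ j, pxC A j t x ^ 2
        + -(I * C) / (2 * m) * lapC A t x) := by rw [← h3, hHJ, neg_neg]
    rw [h1, h2, hU]
    field_simp
    ring_nf
    simp only [I_sq]
    ring
  refine ⟨main, fun hμ1 t x => ?_⟩
  have h := main t x
  rw [hμ1] at h
  simpa using h
end
end
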